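/- Let G be a nearly balanced bipartite graph on 2n−1 vertices with δ(G) ≥ k, where k ≥ 1 and n ≥ (k+1)². If ρ(G) ≥ ρ(S_n^k), then G is traceable unless G = S_n^k. -/

import Mathlib

open SimpleGraph

attribute [local instance] Classical.propDecidable

/-- The (adjacency) spectral radius of a graph, as the largest adjacency eigenvalue. -/
noncomputable def specRad {V : Type*} [Fintype V] [DecidableEq V] (G : SimpleGraph V) : ℝ :=
  sSup (spectrum ℝ (G.adjMatrix ℝ))

/-- The signless Laplacian matrix `Q = D + A` of a graph. -/
noncomputable def signlessLaplacian {V : Type*} [Fintype V] [DecidableEq V]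
    (G : SimpleGraph V) : Matrix V V ℝ :=
  Matrix.diagonal (fun v => (G.degree v : ℝ)) + G.adjMatrix ℝ

/-- The signless Laplacian spectral radius of a graph. -/
noncomputable def qSpec {V : Type*} [Fintype V] [DecidableEq V] (G : SimpleGraph V) : ℝ :=
  sSup (spectrum ℝ (signlessLaplacian G))

/-- A graph is traceable if it has a Hamilton path. -/
def SimpleGraph.IsTraceable {V : Type*} (G : SimpleGraph V) : Prop :=
  ∃ (u v : V) (p : G.Walk u v), p.IsHamiltonian

/-- A graph on `Fin m ⊕ Fin n` is bipartite with bipartition `{Fin m, Fin n}`: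
all edges go between the two parts. -/
def CrossOnly {m n : ℕ} (G : SimpleGraph (Fin m ⊕ Fin n)) : Prop :=
  (∀ x y : Fin m, ¬ G.Adj (Sum.inl x) (Sum.inl y)) ∧
  (∀ x y : Fin n, ¬ G.Adj (Sum.inr x) (Sum.inr y))

/-- The graph `Q_n^k = K_{k,n-k-1} ⊔ Φ_{n-k,k+1}`: a vertex `inl x` with `x < k` is joined to
all of the right side, a vertex `inr y` with `y < n-k-1` is joined to all of the left side,
and there are no other edges. -/
def Qgraph (n k : ℕ) : SimpleGraph (Fin n ⊕ Fin n) :=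
  SimpleGraph.fromRel (fun a b =>
    match a, b with
    | Sum.inl x, Sum.inr y => x.val < k ∨ y.val < n - k - 1
    | _, _ => False)

/-- The graph `R_n^k = K_{k,k} ∪ K_{n-k,n-k}` (disjoint union). -/
def Rgraph (n k : ℕ) : SimpleGraph (Fin n ⊕ Fin n) :=
  SimpleGraph.fromRel (fun a b =>
    match a, b with
    | Sum.inl x, Sum.inr y => (x.val < k ∧ y.val < k) ∨ (k ≤ x.val ∧ k ≤ y.val)
    | _, _ => False)

/-- The graph `S_n^k = K_{k,n-k-1} ⊔ Φ_{n-k,k}` on parts of sizes `n` and `n-1`. -/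
def Sgraph (n k : ℕ) : SimpleGraph (Fin n ⊕ Fin (n - 1)) :=
  SimpleGraph.fromRel (fun a b =>
    match a, b with
    | Sum.inl x, Sum.inr y => x.val < k ∨ y.val < n - k - 1
    | _, _ => False)

/-- The quasi-complement of a bipartite graph: `inl x` and `inr y` are adjacent iff they are
nonadjacent in `G`; no edges inside the parts. -/
def quasiComplement {m n : ℕ} (G : SimpleGraph (Fin m ⊕ Fin n)) : SimpleGraph (Fin m ⊕ Fin n) :=
  SimpleGraph.fromRel (fun a b =>
    match a, b with
    | Sum.inl x, Sum.inr y => ¬ G.Adj (Sum.inl x) (Sum.inr y)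
    | _, _ => False)

/-- `G` is isomorphic to a subgraph of `H`. -/
def IsoSubgraph {V W : Type*} (G : SimpleGraph V) (H : SimpleGraph W) : Prop :=
  ∃ H' : SimpleGraph W, H' ≤ H ∧ Nonempty (G ≃g H')


/-- `l` lists a Hamilton cycle for the relation `R`. -/
def IsCyc {V : Type*} (R : V → V → Prop) (l : List V) : Prop :=
  l.Nodup ∧ (∀ v, v ∈ l) ∧ l.IsChain R ∧ ∀ x ∈ l.getLast?, ∀ y ∈ l.head?, R x y

theorem IsCyc.rot {V : Type*} {R : V → V → Prop} {l₁ l₂ : List V} (h : IsCyc R (l₁ ++ l₂)) :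
    IsCyc R (l₂ ++ l₁) := by
  rcases eq_or_ne l₁ [] with rfl | h1
  · simpa using h
  rcases eq_or_ne l₂ [] with rfl | h2
  · simpa using h
  obtain ⟨a, b, c, d⟩ := h
  rw [List.isChain_append] at c
  refine ⟨List.nodup_append_comm.1 a, fun v => ?_, ?_, ?_⟩
  · have := b v
    simp only [List.mem_append] at this ⊢
    tauto
  · rw [List.isChain_append]
    refine ⟨c.2.1, c.1, ?_⟩
    intro x hx y hy
    apply d
    · rw [List.getLast?_append_of_ne_nil _ h2]; exact hx
    · rw [List.head?_append_of_ne_nil _ h1]; exact hy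
  · intro x hx y hy
    rw [List.getLast?_append_of_ne_nil _ h1] at hx
    rw [List.head?_append_of_ne_nil _ h2] at hy
    exact c.2.2 x hx y hy

theorem cyc_rot_bad {V : Type*} {R R' : V → V → Prop} {l : List V} (h : IsCyc R' l)
    (hn : ¬ IsCyc R l) :
    ∃ l', IsCyc R' l' ∧ ∃ a ∈ l'.getLast?, ∃ b ∈ l'.head?, ¬ R a b := by
  by_cases hc : l.IsChain R
  · refine ⟨l, h, ?_⟩
    by_contra hcon
    push Not at hcon
    exact hn ⟨h.1, h.2.1, hc, hcon⟩
  · rw [List.isChain_iff_forall_rel_of_append_cons_cons] at hc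
    push Not at hc
    obtain ⟨a, b, l1, l2, rfl, hab⟩ := hc
    have h' : IsCyc R' ((l1 ++ [a]) ++ (b :: l2)) := by simpa using h
    refine ⟨_, h'.rot, a, by rw [List.getLast?_append_of_ne_nil _ (by simp)]; simp, b, by simp, hab⟩

theorem path_of_added {V : Type*} {R R' : V → V → Prop} (hs : ∀ a b, R a b → R b a) {x y : V}
    (hR' : ∀ a b, R' a b → R a b ∨ (a = x ∧ b = y) ∨ (a = y ∧ b = x))
    {l : List V} (h : IsCyc R' l) (hn : ¬ IsCyc R l) (h3 : ∀ l : List V, (∀ v, v ∈ l) → 3 ≤ l.length) :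
    ∃ l : List V, l.Nodup ∧ (∀ v, v ∈ l) ∧ l.IsChain R ∧ x ∈ l.head? ∧ y ∈ l.getLast? := by
  obtain ⟨l', ⟨h1, h2, h4, h5⟩, a, ha, b, hb, hab⟩ := cyc_rot_bad h hn
  have hlen := h3 l' h2
  have hab' := (hR' _ _ (h5 a ha b hb)).resolve_left hab
  have hch : l'.IsChain R := by
    rw [List.isChain_iff_getElem] at h4 ⊢
    intro i hi
    have h6 := h4 i hi
    rcases hR' _ _ h6 with h7 | h7
    · exact h7
    exfalso
    have e1 : l'[0] = b := by
      rw [List.head?_eq_getElem?] at hb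
      simp [List.getElem?_eq_some_iff] at hb
      exact hb.2
    have e2 : l'[l'.length - 1] = a := by
      rw [List.getLast?_eq_getElem?] at ha
      simp [List.getElem?_eq_some_iff] at ha
      exact ha.2
    have key : (l'[i] = a ∧ l'[i+1] = b) ∨ (l'[i] = b ∧ l'[i+1] = a) := by
      rcases hab' with ⟨rfl, rfl⟩ | ⟨rfl, rfl⟩ <;> tauto
    rcases key with ⟨k1, k2⟩ | ⟨k1, k2⟩
    · rw [← e1] at k2
      have := (h1.getElem_inj_iff).1 k2
      omega
    · rw [← e1] at k1
      rw [← e2] at k2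
      have := (h1.getElem_inj_iff).1 k1
      have := (h1.getElem_inj_iff).1 k2
      omega
  rcases hab' with ⟨rfl, rfl⟩ | ⟨rfl, rfl⟩
  · refine ⟨l'.reverse, by simpa, by simpa, ?_, by simpa using ha, by simpa using hb⟩
    rw [List.isChain_reverse]
    exact hch.imp (fun a b h => hs _ _ h)
  · exact ⟨l', h1, h2, hch, hb, ha⟩

theorem crossover {V : Type*} {R : V → V → Prop} (hs : ∀ a b, R a b → R b a) {x y p q : V}
    {l₁ l₂ : List V} (h1 : (l₁ ++ p :: q :: l₂).Nodup) (h2 : ∀ v, v ∈ (l₁ ++ p :: q :: l₂))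
    (h3 : (l₁ ++ p :: q :: l₂).IsChain R) (hx : x ∈ (l₁ ++ p :: q :: l₂).head?)
    (hy : y ∈ (l₁ ++ p :: q :: l₂).getLast?) (hp : R p y) (hq : R x q) :
    IsCyc R ((l₁ ++ [p]) ++ (q :: l₂).reverse) := by
  have e : l₁ ++ p :: q :: l₂ = (l₁ ++ [p]) ++ (q :: l₂) := by simp
  rw [e] at h1 h2 h3 hx hy
  rw [List.isChain_append] at h3
  rw [List.head?_append_of_ne_nil _ (by simp)] at hx
  rw [List.getLast?_append_of_ne_nil _ (by simp)] at hy
  have hperm : ((l₁ ++ [p]) ++ (q :: l₂)).Perm ((l₁ ++ [p]) ++ (q :: l₂).reverse) :=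
    (List.reverse_perm _).symm.append_left _
  refine ⟨hperm.nodup_iff.1 h1, fun v => hperm.mem_iff.1 (h2 v), ?_, ?_⟩
  · rw [List.isChain_append]
    refine ⟨h3.1, ?_, ?_⟩
    · rw [List.isChain_reverse]
      exact h3.2.1.imp (fun a b h => hs _ _ h)
    · intro a ha b hb
      have : a = p := by simpa using ha.symm
      rw [List.head?_reverse] at hb
      have : b = y := by
        have := Option.mem_unique hb hy
        exact this
      subst_vars
      exact hp
  · intro a ha b hb
    rw [List.getLast?_append_of_ne_nil _ (by simp)] at ha
    rw [List.head?_append_of_ne_nil _ (by simp)] at hb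
    have h8 : b = x := Option.mem_unique hb hx
    rw [List.getLast?_reverse] at ha
    have : a = q := by simpa using ha.symm
    subst_vars
    exact hs _ _ hq

/-- adjacency on the sum type from a relation between the parts. -/
def bAdj {α β : Type*} (R : α → β → Prop) : α ⊕ β → α ⊕ β → Prop
  | Sum.inl a, Sum.inr b => R a b
  | Sum.inr b, Sum.inl a => R a b
  | _, _ => False

theorem bAdj_symm {α β : Type*} (R : α → β → Prop) (u v : α ⊕ β) (h : bAdj R u v) :
    bAdj R v u := by
  rcases u with u | u <;> rcases v with v | v <;> simp_all [bAdj]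

theorem ore_bip {α β : Type*} [Fintype α] [Fintype β] (R : α → β → Prop) (x : α) (y : β)
    (l : List (α ⊕ β)) (h1 : l.Nodup) (h2 : ∀ v, v ∈ l) (h3 : l.IsChain (bAdj R))
    (hx : Sum.inl x ∈ l.head?) (hy : Sum.inr y ∈ l.getLast?)
    (hc : Fintype.card β + 1 ≤ (Finset.univ.filter fun b => R x b).card +
      (Finset.univ.filter fun a => R a y).card) :
    ∃ l', IsCyc (bAdj R) l' := by
  have hsucc : ∀ a : α, ∃ q : β, ∃ l1 l2, l = l1 ++ Sum.inl a :: Sum.inr q :: l2 := by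
    intro a
    obtain ⟨l1, t, ht⟩ := List.append_of_mem (h2 (Sum.inl a))
    rcases t with _ | ⟨c, l2⟩
    · rw [ht] at hy
      simp at hy
    · have : bAdj R (Sum.inl a) c := by
        rw [List.isChain_iff_forall_rel_of_append_cons_cons] at h3
        exact h3 ht
      rcases c with c | c
      · exact this.elim
      · exact ⟨c, l1, l2, ht⟩
  choose q l1 l2 hq using hsucc
  have hinj : Function.Injective q := by
    intro a a' haa
    have e1 : l[(l1 a).length + 1]? = some (Sum.inr (q a)) := by
      conv_lhs => rw [hq a]
      simp
    have e2 : l[(l1 a').length + 1]? = some (Sum.inr (q a')) := by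
      conv_lhs => rw [hq a']
      simp
    have e3 : l[(l1 a).length]? = some (Sum.inl a) := by
      conv_lhs => rw [hq a]
      simp
    have e4 : l[(l1 a').length]? = some (Sum.inl a') := by
      conv_lhs => rw [hq a']
      simp
    rw [← haa] at e2
    rw [List.getElem?_eq_some_iff] at e1 e2
    obtain ⟨i1, e1⟩ := e1
    obtain ⟨i2, e2⟩ := e2
    have := (h1.getElem_inj_iff).1 (e1.trans e2.symm)
    have h' : (l1 a).length = (l1 a').length := by omega
    rw [h', e4] at e3
    simpa using e3.symm
  have : ∃ b, b ∈ (Finset.univ.filter fun b => R x b) ∩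
      (Finset.univ.filter fun a => R a y).image q := by
    by_contra hcon
    push Not at hcon
    have hd : Disjoint (Finset.univ.filter fun b => R x b)
      ((Finset.univ.filter fun a => R a y).image q) := by
      rw [Finset.disjoint_iff_inter_eq_empty]
      exact Finset.eq_empty_of_forall_notMem hcon
    have := Finset.card_union_of_disjoint hd
    rw [Finset.card_image_of_injective _ hinj] at this
    have h9 := Finset.card_le_univ ((Finset.univ.filter fun b => R x b) ∪
      ((Finset.univ.filter fun a => R a y).image q))
    omega
  obtain ⟨b, hb⟩ := this
  simp only [Finset.mem_inter, Finset.mem_filter, Finset.mem_univ, true_and, Finset.mem_image] at hb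
  obtain ⟨hb1, a, ha, rfl⟩ := hb
  have e := hq a
  rw [e] at h1 h2 h3 hx hy
  exact ⟨_, crossover (bAdj_symm R) h1 h2 h3 hx hy (by exact ha) (by exact hb1)⟩

theorem closure_bound {α β : Type*} [Fintype α] [Fintype β] (R : α → β → Prop)
    (hα : 2 ≤ Fintype.card α) (hβ : 2 ≤ Fintype.card β)
    (hn : ¬ ∃ l, IsCyc (bAdj R) l)
    (hmax : ∀ R' : α → β → Prop, (∀ a b, R a b → R' a b) → (¬ ∃ l, IsCyc (bAdj R') l) →
      ∀ a b, R' a b → R a b) (x : α) (y : β) (hxy : ¬ R x y) :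
    (Finset.univ.filter fun b => R x b).card +
      (Finset.univ.filter fun a => R a y).card ≤ Fintype.card β := by
  by_contra hcon
  have hham : ∃ l, IsCyc (bAdj fun a b => R a b ∨ (a = x ∧ b = y)) l := by
    by_contra h
    exact hxy (hmax _ (fun a b hab => Or.inl hab) h x y (Or.inr ⟨rfl, rfl⟩))
  obtain ⟨l, hl⟩ := hham
  have hn' := fun h => hn ⟨l, h⟩
  obtain ⟨l, h1, h2, h3, h4, h5⟩ := path_of_added (R := bAdj R) (bAdj_symm R)
    (x := Sum.inl x) (y := Sum.inr y) (by
      intro u v huv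
      rcases u with u | u <;> rcases v with v | v <;> simp [bAdj] at huv ⊢ <;> tauto) hl hn' (by
      intro l hl
      have : Fintype.card (α ⊕ β) ≤ l.toFinset.card := by
        rw [← Finset.card_univ]
        apply Finset.card_le_card
        intro v _
        simpa using hl v
      have h' := l.toFinset_card_le
      rw [Fintype.card_sum] at this
      omega)
  exact hn (ore_bip R x y l h1 h2 h3 h4 h5 (by omega))

theorem filter_split {α : Type*} [Fintype α] (p : α → Prop) :
    (Finset.univ.filter p).card + (Finset.univ.filter fun a => ¬ p a).card = Fintype.card α := by
  rw [← Finset.card_univ]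
  exact Finset.card_filter_add_card_filter_not (s := Finset.univ) p

theorem card_le_card_erase_add_one' {α : Type*} (s : Finset α) (a : α) :
    s.card ≤ (s.erase a).card + 1 := by
  have := Finset.pred_card_le_card_erase (s := s) (a := a)
  omega

theorem arith_pq (k c p q : ℕ) (h1 : p ≤ c + k + 1) (h2 : q ≤ c + k + 1)
    (h3 : c + (2 * k + 2) ≤ p + q) : (k + 1) * (c + k + 1) ≤ p * q := by
  obtain ⟨r, rfl⟩ : ∃ r, p = r + (k + 1) := ⟨p - (k + 1), by omega⟩
  obtain ⟨s, rfl⟩ : ∃ s, q = s + (k + 1) := ⟨q - (k + 1), by omega⟩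
  have : c ≤ r + s := by omega
  nlinarith [Nat.zero_le (r * s), Nat.zero_le k, Nat.mul_le_mul_left k this]

theorem max_struct {α β : Type*} [Fintype α] [Fintype β] (R : α → β → Prop) (n k : ℕ)
    (hα : Fintype.card α = n) (hβ : Fintype.card β = n) (hk : 1 ≤ k) (hnk : 2 * k + 2 ≤ n)
    (hcl : ∀ x y, ¬ R x y → (Finset.univ.filter fun b => R x b).card +
      (Finset.univ.filter fun a => R a y).card ≤ n)
    (hdα : ∀ a, k + 1 ≤ (Finset.univ.filter fun b => R a b).card)
    (hdβ : ∀ b, k ≤ (Finset.univ.filter fun a => R a b).card)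
    (hM : ∑ b : β, (Finset.univ.filter fun a => ¬ R a b).card < (k + 1) * (n - k - 1))
    (hex : ∃ x y, ¬ R x y) :
    ∃ (S : Finset β) (B : Finset α), S.card = k ∧ B.card = k ∧ ∀ s ∈ S, ∀ a, R a s → a ∈ B := by
  obtain ⟨c, rfl⟩ : ∃ c, n = c + (2 * k + 2) := ⟨n - (2 * k + 2), by omega⟩
  set n := c + (2 * k + 2) with hn
  let mα : α → ℕ := fun a => (Finset.univ.filter fun b => ¬ R a b).card
  let mβ : β → ℕ := fun b => (Finset.univ.filter fun a => ¬ R a b).card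
  have hsα : ∀ a, (Finset.univ.filter fun b => R a b).card + mα a = n := fun a => by
    rw [← hβ]; exact filter_split _
  have hsβ : ∀ b, (Finset.univ.filter fun a => R a b).card + mβ b = n := fun b => by
    rw [← hα]; exact filter_split _
  have hcl' : ∀ x y, ¬ R x y → n ≤ mα x + mβ y := fun x y h => by
    have := hcl x y h; have := hsα x; have := hsβ y; omega
  have hmα : ∀ a, mα a ≤ n - k - 1 := fun a => by
    have := hdα a; have := hsα a; omega
  have hmβ : ∀ b, mβ b ≤ n - k := fun b => by
    have := hdβ b; have := hsβ b; omega
  obtain ⟨⟨x, y⟩, hxy, hmin⟩ := Finset.exists_min_image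
    (Finset.univ.filter fun p : α × β => ¬ R p.1 p.2) (fun p => mα p.1 + mβ p.2) (by
      obtain ⟨x, y, h⟩ := hex
      exact ⟨(x, y), by simpa using h⟩)
  simp only [Finset.mem_filter, Finset.mem_univ, true_and, Prod.forall] at hxy hmin
  have hpq := hcl' x y hxy
  set S := Finset.univ.filter fun b => ¬ R x b with hS
  have hSc : S.card = mα x := rfl
  have hSm : ∀ b ∈ S, mβ y ≤ mβ b := by
    intro b hb
    have := hmin x b (by simpa [hS] using hb)
    omega
  have hsplit : ∑ b ∈ S, mβ b + ∑ b ∈ Sᶜ, mβ b = ∑ b, mβ b := Finset.sum_add_sum_compl S mβ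
  have hSsum : mα x * mβ y ≤ ∑ b ∈ S, mβ b := by
    rw [← hSc, ← smul_eq_mul]
    exact Finset.card_nsmul_le_sum S mβ _ hSm
  have hM' : ∑ b, mβ b < (k + 1) * (n - k - 1) := hM
  have e1 : n - k - 1 = c + k + 1 := by omega
  have e2 : n - k = c + k + 2 := by omega
  rw [e1] at hM' hmα
  rw [e2] at hmβ
  have hq : mβ y = c + k + 2 := by
    by_contra hne
    have h1 : mβ y ≤ c + k + 1 := by have := hmβ y; omega
    have h2 := hmα x
    have h3 : (k + 1) * (c + k + 1) ≤ mα x * mβ y := by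
      exact arith_pq k c _ _ (by omega) (by omega) (by omega)
    omega
  have hp : mα x = k := by
    have h1 : k ≤ mα x := by omega
    by_contra hne
    have h2 : k + 1 ≤ mα x := by omega
    have h3 : (k + 1) * (c + k + 2) ≤ mα x * mβ y := by
      rw [hq]; exact Nat.mul_le_mul_right _ h2
    have h4 : (k + 1) * (c + k + 1) ≤ (k + 1) * (c + k + 2) := Nat.mul_le_mul_left _ (by omega)
    omega
  have hSk : S.card = k := hSc.trans hp
  have hT : ∑ b ∈ Sᶜ, mβ b ≤ c := by
    rw [hp, hq] at hSsum
    nlinarith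
  have hTfull : ∀ a, ∀ t ∉ S, R a t := by
    intro a t ht
    by_contra hat
    have h1 := hcl' a t hat
    have h2 : mα a ≤ k + (Sᶜ.filter fun b => ¬ R a b).card := by
      have : (Finset.univ.filter fun b => ¬ R a b) ⊆ S ∪ (Sᶜ.filter fun b => ¬ R a b) := by
        intro b hb
        simp only [Finset.mem_filter, Finset.mem_univ, true_and, Finset.mem_union,
          Finset.mem_compl] at hb ⊢
        tauto
      have h4 := (Finset.card_le_card this).trans (Finset.card_union_le _ _)
      rw [hSk] at h4
      exact h4
    have h3 : mβ t + ((Sᶜ.erase t).filter fun b => ¬ R a b).card ≤ ∑ b ∈ Sᶜ, mβ b := by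
      rw [← Finset.add_sum_erase Sᶜ mβ (Finset.mem_compl.2 ht)]
      gcongr
      rw [Finset.card_filter]
      apply Finset.sum_le_sum
      intro b _
      split_ifs with h
      · exact Nat.zero_le _
      · exact Finset.card_pos.2 ⟨a, by simpa using h⟩
    have h4 : (Sᶜ.filter fun b => ¬ R a b).card ≤
        ((Sᶜ.erase t).filter fun b => ¬ R a b).card + 1 := by
      rw [Finset.filter_erase]
      exact card_le_card_erase_add_one' _ _
    omega
  obtain ⟨s₀, hs₀⟩ : S.Nonempty := Finset.card_pos.1 (by omega)
  have hSdeg : ∀ s ∈ S, mβ s = c + k + 2 := fun s hs => by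
    have := hSm s hs; have := hmβ s; omega
  refine ⟨S, Finset.univ.filter fun a => R a s₀, hSk, ?_, ?_⟩
  · have := hsβ s₀
    have := hSdeg s₀ hs₀
    omega
  · intro s hs a has
    by_contra h
    have h0 : ¬ R a s₀ := by simpa using h
    have h1 := hcl' a s₀ h0
    have h2 : mα a ≤ (S.erase s).card := by
      apply Finset.card_le_card
      intro b hb
      simp only [Finset.mem_filter, Finset.mem_univ, true_and] at hb
      rw [Finset.mem_erase]
      refine ⟨fun hbs => hb (hbs ▸ has), ?_⟩
      by_contra hbS
      exact hb (hTfull a b hbS)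
    rw [Finset.card_erase_of_mem hs] at h2
    have := hSdeg s₀ hs₀
    omega

theorem balanced_struct {α β : Type*} [Fintype α] [Fintype β] (R : α → β → Prop) (n k : ℕ)
    (hα : Fintype.card α = n) (hβ : Fintype.card β = n) (hk : 1 ≤ k) (hnk : 2 * k + 2 ≤ n)
    (hdα : ∀ a, k + 1 ≤ (Finset.univ.filter fun b => R a b).card)
    (hdβ : ∀ b, k ≤ (Finset.univ.filter fun a => R a b).card)
    (hM : ∑ b : β, (Finset.univ.filter fun a => ¬ R a b).card < (k + 1) * (n - k - 1))
    (hham : ¬ ∃ l, IsCyc (bAdj R) l)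
    (hcomp : ∃ l, IsCyc (bAdj fun (_ : α) (_ : β) => True) l) :
    ∃ (S : Finset β) (B : Finset α), S.card = k ∧ B.card = k ∧ ∀ s ∈ S, ∀ a, R a s → a ∈ B := by
  obtain ⟨R', hle, hmax⟩ := (Set.toFinite {R : α → β → Prop | ¬ ∃ l, IsCyc (bAdj R) l}).exists_le_maximal
    (a := R) hham
  have hle' : ∀ a b, R a b → R' a b := fun a b h => hle a b h
  have hn' : ¬ ∃ l, IsCyc (bAdj R') l := hmax.1
  obtain ⟨S, B, h1, h2, h3⟩ := max_struct R' n k hα hβ hk hnk (by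
      intro x y hxy
      rw [← hβ]
      exact closure_bound R' (by omega) (by omega) hn'
        (fun R'' hR hR2 a b h => hmax.2 (y := R'') hR2 hR a b h) x y hxy)
    (fun a => (hdα a).trans (Finset.card_le_card (fun b hb => by
      simp only [Finset.mem_filter, Finset.mem_univ, true_and] at hb ⊢; exact hle' _ _ hb)))
    (fun a => (hdβ a).trans (Finset.card_le_card (fun b hb => by
      simp only [Finset.mem_filter, Finset.mem_univ, true_and] at hb ⊢; exact hle' _ _ hb)))
    (lt_of_le_of_lt (Finset.sum_le_sum fun b _ => Finset.card_le_card (fun a ha => by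
      simp only [Finset.mem_filter, Finset.mem_univ, true_and] at ha ⊢
      exact fun h => ha (hle' _ _ h))) hM)
    (by
      by_contra hcon
      push Not at hcon
      have : R' = fun _ _ => True := by
        funext a b
        simpa using hcon a b
      rw [this] at hn'
      exact hn' hcomp)
  exact ⟨S, B, h1, h2, fun s hs a h => h3 s hs a (hle' _ _ h)⟩

theorem complete_aux {α β : Type*} (la : List α) : ∀ lb : List β, la.length = lb.length →
    ∃ l : List (α ⊕ β), l.IsChain (bAdj fun (_ : α) (_ : β) => True) ∧
      (∀ y ∈ l.head?, ∃ a, y = Sum.inl a) ∧ (∀ x ∈ l.getLast?, ∃ b, x = Sum.inr b) ∧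
      l.Perm (la.map Sum.inl ++ lb.map Sum.inr) := by
  induction la with
  | nil =>
    intro lb h
    have : lb = [] := by simpa using h.symm
    subst this
    exact ⟨[], by simp, by simp, by simp, by simp⟩
  | cons a la ih =>
    intro lb h
    rcases lb with _ | ⟨b, lb⟩
    · simp at h
    obtain ⟨l, h1, h2, h3, h4⟩ := ih lb (by simpa using h)
    refine ⟨Sum.inl a :: Sum.inr b :: l, ?_, by simp, ?_, ?_⟩
    · rw [List.isChain_cons, List.isChain_cons]
      refine ⟨by simp [bAdj], ?_, h1⟩
      intro y hy
      obtain ⟨a, rfl⟩ := h2 y hy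
      trivial
    · intro x hx
      rcases eq_or_ne l [] with rfl | hl
      · simp at hx
        exact ⟨b, hx.symm⟩
      · apply h3
        rw [show Sum.inl a :: Sum.inr b :: l = [Sum.inl a, Sum.inr b] ++ l by simp,
          List.getLast?_append_of_ne_nil _ hl] at hx
        exact hx
    · simp only [List.map_cons, List.cons_append]
      refine List.Perm.cons _ ?_
      exact (List.Perm.cons _ h4).trans List.perm_middle.symm

theorem complete_cyc {α β : Type*} [Fintype α] [Fintype β] (h : Fintype.card α = Fintype.card β) :
    ∃ l, IsCyc (bAdj fun (_ : α) (_ : β) => True) l := by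
  obtain ⟨l, h1, h2, h3, h4⟩ := complete_aux (Finset.univ : Finset α).toList
    (Finset.univ : Finset β).toList (by simpa using h)
  refine ⟨l, ?_, ?_, h1, ?_⟩
  · rw [h4.nodup_iff, List.nodup_append]
    refine ⟨(Finset.nodup_toList _).map Sum.inl_injective,
      (Finset.nodup_toList _).map Sum.inr_injective, ?_⟩
    simp
  · intro v
    rw [h4.mem_iff]
    rcases v with v | v <;> simp
  · intro x hx y hy
    obtain ⟨a, rfl⟩ := h2 y hy
    obtain ⟨b, rfl⟩ := h3 x hx
    trivial

/-- The relation obtained by adding a universal vertex `none` on the right. -/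
def optRel {m n : ℕ} (G : SimpleGraph (Fin m ⊕ Fin n)) (a : Fin m) : Option (Fin n) → Prop
  | none => True
  | some b => G.Adj (Sum.inl a) (Sum.inr b)

theorem traceable_of_list {V : Type*} {G : SimpleGraph V} (t : List V) (hne : t ≠ [])
    (hnd : t.Nodup) (hmem : ∀ v, v ∈ t) (hch : t.IsChain G.Adj) : G.IsTraceable := by
  refine ⟨_, _, Walk.ofSupport t hne hch, ?_⟩
  apply Walk.IsPath.isHamiltonian_of_mem
  · rw [Walk.isPath_def, Walk.support_ofSupport]
    exact hnd
  · intro w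
    rw [Walk.support_ofSupport]
    exact hmem w

theorem traceable_of_cyc {m n : ℕ} (hm : 1 ≤ m) (G : SimpleGraph (Fin m ⊕ Fin n))
    (h : ∃ l, IsCyc (bAdj (optRel G)) l) :
    G.IsTraceable := by
  obtain ⟨l, hl⟩ := h
  obtain ⟨l1, l2, rfl⟩ := List.append_of_mem (hl.2.1 (Sum.inr none))
  have hl' := hl.rot
  rw [List.cons_append] at hl'
  obtain ⟨h1, h2, h3, -⟩ := hl'
  set t := l2 ++ l1
  rw [List.nodup_cons] at h1
  have h3 := (List.isChain_cons.1 h3).2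
  obtain ⟨t', ht'⟩ : t ∈ Set.range (List.map (Sum.map id some : Fin m ⊕ Fin n → _)) := by
    rw [Set.range_list_map]
    intro x hx
    rcases x with x | _ | x
    · exact ⟨Sum.inl x, rfl⟩
    · exact absurd hx h1.1
    · exact ⟨Sum.inr x, rfl⟩
  have hinj : Function.Injective (Sum.map id some : Fin m ⊕ Fin n → Fin m ⊕ Option (Fin n)) :=
    Function.Injective.sumMap Function.injective_id (Option.some_injective _)
  have hmem : ∀ v, v ∈ t' := by
    intro v
    have := h2 (Sum.map id some v)
    rw [List.mem_cons, ← ht', List.mem_map_of_injective hinj] at this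
    refine this.resolve_left ?_
    rcases v with v | v <;> simp
  have hnd : t'.Nodup := by
    have := h1.2
    rw [← ht'] at this
    exact this.of_map
  have hch : t'.IsChain G.Adj := by
    rw [← ht', List.isChain_map] at h3
    refine h3.imp ?_
    intro a b hab
    rcases a with a | a <;> rcases b with b | b <;> simp [bAdj, optRel] at hab
    · exact hab
    · exact hab.symm
  have hne : t' ≠ [] := List.ne_nil_of_mem (hmem (Sum.inl ⟨0, hm⟩))
  exact traceable_of_list t' hne hnd hmem hch

theorem nontraceable_struct (n k : ℕ) (G : SimpleGraph (Fin n ⊕ Fin (n - 1)))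
    (hk : 1 ≤ k) (hn : (k + 1) ^ 2 ≤ n)
    (hdα : ∀ a, k ≤ (Finset.univ.filter fun b => G.Adj (Sum.inl a) (Sum.inr b)).card)
    (hdβ : ∀ b, k ≤ (Finset.univ.filter fun a => G.Adj (Sum.inl a) (Sum.inr b)).card)
    (hE : n * (n - k - 1) < ∑ b, (Finset.univ.filter fun a => G.Adj (Sum.inl a) (Sum.inr b)).card)
    (hnt : ¬ G.IsTraceable) :
    ∃ (S : Finset (Fin (n - 1))) (B : Finset (Fin n)), S.card = k ∧ B.card = k ∧
      ∀ s ∈ S, ∀ a, G.Adj (Sum.inl a) (Sum.inr s) → a ∈ B := by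
  have hnk : 2 * k + 2 ≤ n := by nlinarith
  obtain ⟨S, B, h1, h2, h3⟩ := balanced_struct (optRel G) n k (by simp) (by simp; omega) hk hnk
    (by
      intro a
      have e : (Finset.univ.filter fun b => optRel G a b) =
        Finset.insertNone (Finset.univ.filter fun b => G.Adj (Sum.inl a) (Sum.inr b)) := by
        ext b
        rw [Finset.mem_filter]
        rcases b with _ | b <;> simp [optRel]
      rw [e, Finset.card_insertNone]
      exact Nat.succ_le_succ (hdα a))
    (by
      intro b
      rcases b with _ | b
      · rw [Finset.filter_true_of_mem (p := fun a => optRel G a none) (fun _ _ => trivial)]; simp; omega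
      · exact hdβ b)
    (by
      rw [Fintype.sum_option]
      have e : ∀ b : Fin (n - 1), (Finset.univ.filter fun a => ¬ optRel G a (some b)).card +
          (Finset.univ.filter fun a => G.Adj (Sum.inl a) (Sum.inr b)).card = n := by
        intro b
        have := filter_split (fun a => G.Adj (Sum.inl a) (Sum.inr b))
        rw [Fintype.card_fin, add_comm] at this
        exact this
      have e2 := Finset.sum_congr (s₁ := (Finset.univ : Finset (Fin (n - 1)))) rfl (fun b _ => e b)
      rw [Finset.sum_add_distrib] at e2
      simp only [Finset.sum_const, Finset.card_univ, Fintype.card_fin, smul_eq_mul] at e2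
      have e3 : (Finset.univ.filter fun a => ¬ optRel G a none).card = 0 := by simp [optRel]
      rw [e3]
      obtain ⟨c, rfl⟩ : ∃ c, n = c + k + 1 := ⟨n - k - 1, by omega⟩
      have e4 : c + k + 1 - 1 = c + k := rfl
      have e5 : c + k + 1 - k - 1 = c := by omega
      rw [e5] at hE ⊢
      simp only [e4] at *
      nlinarith)
    (fun h => hnt (traceable_of_cyc (by omega) G h))
    (complete_cyc (by simp; omega))
  have hnone : none ∉ S := by
    intro h
    have : Finset.univ ⊆ B := fun a _ => h3 none h a trivial
    have := Finset.card_le_card this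
    simp at this
    omega
  refine ⟨S.eraseNone, B, ?_, h2, fun s hs a h => h3 (some s) (Finset.mem_eraseNone.1 hs) a h⟩
  rw [Finset.card_eraseNone_of_not_mem hnone, h1]

section spectral
variable {V : Type*} [Fintype V] [DecidableEq V]

theorem adj_herm (G : SimpleGraph V) : (G.adjMatrix ℝ).IsHermitian := by
  rw [Matrix.IsHermitian, Matrix.conjTranspose_eq_transpose_of_trivial]
  exact G.isSymm_adjMatrix

theorem specRad_mem [Nonempty V] (G : SimpleGraph V) :
    specRad G ∈ spectrum ℝ (G.adjMatrix ℝ) := by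
  apply Set.Nonempty.csSup_mem
  · rw [(adj_herm G).spectrum_real_eq_range_eigenvalues]
    exact Set.range_nonempty _
  · exact Matrix.finite_real_spectrum

theorem le_specRad (G : SimpleGraph V) {r : ℝ} (h : r ∈ spectrum ℝ (G.adjMatrix ℝ)) :
    r ≤ specRad G :=
  le_csSup Matrix.finite_real_spectrum.bddAbove h

theorem specRad_eigvec [Nonempty V] (G : SimpleGraph V) :
    ∃ z : V → ℝ, z ≠ 0 ∧ (G.adjMatrix ℝ).mulVec z = specRad G • z := by
  have h := specRad_mem G
  rw [← Matrix.spectrum_toLin', ← Module.End.hasEigenvalue_iff_mem_spectrum] at h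
  obtain ⟨z, hz⟩ := h.exists_hasEigenvector
  exact ⟨z, hz.2, by simpa using hz.apply_eq_smul⟩

theorem specRad_psd (G : SimpleGraph V) :
    (algebraMap ℝ (Matrix V V ℝ) (specRad G) - G.adjMatrix ℝ).PosSemidef := by
  rw [Matrix.posSemidef_iff_isHermitian_and_spectrum_nonneg]
  constructor
  · apply Matrix.IsHermitian.sub _ (adj_herm G)
    rw [Matrix.algebraMap_eq_diagonal]
    exact Matrix.isHermitian_diagonal _
  · rw [← spectrum.singleton_sub_eq]
    rintro _ ⟨a, ha, b, hb, rfl⟩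
    have := le_specRad G hb
    simp only [Set.mem_singleton_iff] at ha
    subst ha
    simpa using this

theorem psd_apply (G : SimpleGraph V) (z : V → ℝ) :
    (algebraMap ℝ (Matrix V V ℝ) (specRad G) - G.adjMatrix ℝ).mulVec z
      = specRad G • z - (G.adjMatrix ℝ).mulVec z := by
  rw [Matrix.sub_mulVec, Algebra.algebraMap_eq_smul_one, Matrix.smul_mulVec, Matrix.one_mulVec]

theorem rayleigh_le (G : SimpleGraph V) (z : V → ℝ) :
    z ⬝ᵥ (G.adjMatrix ℝ).mulVec z ≤ specRad G * (z ⬝ᵥ z) := by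
  have h := (specRad_psd G).dotProduct_mulVec_nonneg z
  rw [psd_apply, star_trivial, dotProduct_sub, dotProduct_smul, smul_eq_mul] at h
  linarith

theorem rayleigh_eq (G : SimpleGraph V) (z : V → ℝ)
    (h : specRad G * (z ⬝ᵥ z) ≤ z ⬝ᵥ (G.adjMatrix ℝ).mulVec z) :
    (G.adjMatrix ℝ).mulVec z = specRad G • z := by
  have h1 := rayleigh_le G z
  have h2 := ((specRad_psd G).dotProduct_mulVec_zero_iff z).1 (by
    rw [psd_apply, star_trivial, dotProduct_sub, dotProduct_smul, smul_eq_mul]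
    linarith)
  rw [psd_apply] at h2
  exact (sub_eq_zero.1 h2).symm

theorem dot_self_pos {z : V → ℝ} (h : z ≠ 0) : 0 < z ⬝ᵥ z := by
  have h1 : 0 ≤ z ⬝ᵥ z := Finset.sum_nonneg fun i _ => mul_self_nonneg _
  rcases h1.lt_or_eq with h2 | h2
  · exact h2
  · exact absurd (dotProduct_self_eq_zero.1 h2.symm) h

theorem mono_eq [Nonempty V] (G S : SimpleGraph V) (hS : S.Connected) (e : V ≃ V)
    (he : ∀ a b, G.Adj a b → S.Adj (e a) (e b)) (hρ : specRad S ≤ specRad G) :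
    ∀ a b, S.Adj (e a) (e b) → G.Adj a b := by
  obtain ⟨z, hz, hzG⟩ := specRad_eigvec G
  let w : V → ℝ := fun b => |z (e.symm b)|
  have hw0 : ∀ b, 0 ≤ w b := fun b => abs_nonneg _
  have hwe : ∀ a, w (e a) = |z a| := fun a => by simp [w]
  have hww : w ⬝ᵥ w = z ⬝ᵥ z := by
    simp only [dotProduct]
    rw [← Equiv.sum_comp e]
    simp [hwe]
  have hS1 : w ⬝ᵥ (S.adjMatrix ℝ).mulVec w =
      ∑ a, ∑ b, (S.adjMatrix ℝ (e a) (e b)) * (|z a| * |z b|) := by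
    simp only [dotProduct, Matrix.mulVec]
    rw [← Equiv.sum_comp e]
    refine Finset.sum_congr rfl fun a _ => ?_
    rw [Finset.mul_sum, ← Equiv.sum_comp e]
    refine Finset.sum_congr rfl fun b _ => ?_
    rw [hwe, hwe]; ring
  have hG1 : specRad G * (z ⬝ᵥ z) = ∑ a, ∑ b, (G.adjMatrix ℝ a b) * (z a * z b) := by
    rw [← smul_eq_mul, ← dotProduct_smul, ← hzG]
    simp only [dotProduct, Matrix.mulVec]
    refine Finset.sum_congr rfl fun a _ => ?_
    rw [Finset.mul_sum]
    refine Finset.sum_congr rfl fun b _ => ?_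
    ring
  have hGS : ∀ a b, (G.adjMatrix ℝ a b) * (z a * z b) ≤
      (S.adjMatrix ℝ (e a) (e b)) * (|z a| * |z b|) := by
    intro a b
    simp only [SimpleGraph.adjMatrix_apply]
    by_cases h : G.Adj a b
    · rw [if_pos h, if_pos (he a b h), one_mul, one_mul, ← abs_mul]
      exact le_abs_self _
    · rw [if_neg h, zero_mul]
      split_ifs <;> positivity
  have hsum : specRad G * (z ⬝ᵥ z) ≤ w ⬝ᵥ (S.adjMatrix ℝ).mulVec w := by
    rw [hG1, hS1]
    exact Finset.sum_le_sum fun a _ => Finset.sum_le_sum fun b _ => hGS a b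
  have hzz := dot_self_pos hz
  have hSG : specRad S * (w ⬝ᵥ w) ≤ specRad G * (z ⬝ᵥ z) := by
    rw [hww]; exact mul_le_mul_of_nonneg_right hρ hzz.le
  have heig := rayleigh_eq S w (hSG.trans hsum)
  have hprop : ∀ a b, S.Adj a b → w a = 0 → w b = 0 := by
    intro a b hab ha
    have h1 := congrFun heig a
    rw [Pi.smul_apply, ha, smul_zero] at h1
    simp only [Matrix.mulVec, dotProduct] at h1
    rw [Finset.sum_eq_zero_iff_of_nonneg (fun i _ => mul_nonneg (by
      rw [SimpleGraph.adjMatrix_apply]; split_ifs <;> norm_num) (hw0 i))] at h1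
    simpa [hab] using h1 b (Finset.mem_univ _)
  have hpos : ∀ a, 0 < w a := by
    intro a
    rcases (hw0 a).lt_or_eq with h | h
    · exact h
    exfalso
    apply hz
    have hall : ∀ b, w b = 0 := by
      intro b
      obtain ⟨p⟩ := hS.preconnected a b
      have : ∀ (u v : V) (p : S.Walk u v), w u = 0 → w v = 0 := by
        intro u v p
        induction p with
        | nil => exact id
        | cons h _ ih => exact fun hu => ih (hprop _ _ h hu)
      exact this a b p h.symm
    funext b
    have := hall (e b)
    rw [hwe] at this
    simpa using this
  intro a b hab
  by_contra hn
  have hlt : ∑ a, ∑ b, (G.adjMatrix ℝ a b) * (z a * z b) <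
      ∑ a, ∑ b, (S.adjMatrix ℝ (e a) (e b)) * (|z a| * |z b|) := by
    refine Finset.sum_lt_sum (fun a _ => Finset.sum_le_sum fun b _ => hGS a b)
      ⟨a, Finset.mem_univ _, Finset.sum_lt_sum (fun b _ => hGS a b) ⟨b, Finset.mem_univ _, ?_⟩⟩
    have h1 := hpos (e a)
    have h2 := hpos (e b)
    rw [hwe] at h1 h2
    simp only [SimpleGraph.adjMatrix_apply, if_neg hn, if_pos hab, zero_mul, one_mul]
    positivity
  rw [← hG1, ← hS1] at hlt
  have := rayleigh_le S w
  linarith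

end spectral

theorem specRad_sq_le {m n : ℕ} [Nonempty (Fin m ⊕ Fin n)] (G : SimpleGraph (Fin m ⊕ Fin n))
    (hG : CrossOnly G) : specRad G ^ 2 ≤
      ((∑ b, (Finset.univ.filter fun a => G.Adj (Sum.inl a) (Sum.inr b)).card : ℕ) : ℝ) := by
  obtain ⟨z, hz, hzG⟩ := specRad_eigvec G
  set ρ := specRad G
  let M : Fin m → Fin n → ℝ := fun a b => if G.Adj (Sum.inl a) (Sum.inr b) then 1 else 0
  let u : Fin m → ℝ := fun a => z (Sum.inl a)
  let v : Fin n → ℝ := fun b => z (Sum.inr b)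
  have hE : ((∑ b, (Finset.univ.filter fun a => G.Adj (Sum.inl a) (Sum.inr b)).card : ℕ) : ℝ)
      = ∑ b, ∑ a, M a b ^ 2 := by
    push_cast
    refine Finset.sum_congr rfl fun b _ => ?_
    rw [Finset.card_filter]
    push_cast
    refine Finset.sum_congr rfl fun a _ => ?_
    simp only [M]
    split_ifs <;> norm_num
  rw [hE]
  have hu : ∀ a, ρ * u a = ∑ b, M a b * v b := by
    intro a
    have := congrFun hzG (Sum.inl a)
    rw [Pi.smul_apply, smul_eq_mul] at this
    rw [← this]
    simp only [Matrix.mulVec, dotProduct, Fintype.sum_sum_type, SimpleGraph.adjMatrix_apply, hG.1]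
    simp [M, v]
  have hv : ∀ b, ρ * v b = ∑ a, M a b * u a := by
    intro b
    have := congrFun hzG (Sum.inr b)
    rw [Pi.smul_apply, smul_eq_mul] at this
    rw [← this]
    simp only [Matrix.mulVec, dotProduct, Fintype.sum_sum_type, SimpleGraph.adjMatrix_apply, hG.2]
    simp [M, u, G.adj_comm (Sum.inr b)]
  have h1 : ρ ^ 2 * ∑ a, u a ^ 2 ≤ (∑ b, ∑ a, M a b ^ 2) * ∑ b, v b ^ 2 := by
    rw [Finset.sum_comm, Finset.mul_sum, Finset.sum_mul]
    refine Finset.sum_le_sum fun a _ => ?_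
    rw [← mul_pow, hu]
    exact Finset.sum_mul_sq_le_sq_mul_sq _ _ _
  have h2 : ρ ^ 2 * ∑ b, v b ^ 2 ≤ (∑ b, ∑ a, M a b ^ 2) * ∑ a, u a ^ 2 := by
    rw [Finset.mul_sum, Finset.sum_mul]
    refine Finset.sum_le_sum fun a _ => ?_
    rw [← mul_pow, hv]
    exact Finset.sum_mul_sq_le_sq_mul_sq _ _ _
  have hpos := dot_self_pos hz
  have h3 : z ⬝ᵥ z = ∑ a, u a ^ 2 + ∑ b, v b ^ 2 := by
    simp [dotProduct, Fintype.sum_sum_type, u, v, sq]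
  rw [h3] at hpos
  nlinarith

theorem Sgraph_adj (n k : ℕ) (x : Fin n) (y : Fin (n - 1)) :
    (Sgraph n k).Adj (Sum.inl x) (Sum.inr y) ↔ x.val < k ∨ y.val < n - k - 1 := by
  simp [Sgraph]

theorem Sgraph_cross (n k : ℕ) : CrossOnly (Sgraph n k) := by
  constructor <;> intro x y <;> simp [Sgraph]

theorem Sgraph_connected (n k : ℕ) (hk : 1 ≤ k) (hn : k + 2 ≤ n) : (Sgraph n k).Connected := by
  have h0 : ∀ v, (Sgraph n k).Reachable v (Sum.inl ⟨0, by omega⟩) := by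
    have hr : ∀ y, (Sgraph n k).Adj (Sum.inl ⟨0, by omega⟩) (Sum.inr y) := fun y =>
      (Sgraph_adj n k _ _).2 (Or.inl hk)
    intro v
    rcases v with x | y
    · have : (Sgraph n k).Adj (Sum.inl x) (Sum.inr ⟨0, by omega⟩) :=
        (Sgraph_adj n k _ _).2 (Or.inr (by simp; omega))
      exact this.reachable.trans (hr _).symm.reachable
    · exact (hr y).symm.reachable
  have : Nonempty (Fin n ⊕ Fin (n - 1)) := ⟨Sum.inl ⟨0, by omega⟩⟩
  exact Connected.mk fun u v => (h0 u).trans (h0 v).symm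

theorem Sgraph_lower (n k : ℕ) (hk : 1 ≤ k) (hn : k + 2 ≤ n) :
    ((n * (n - k - 1) : ℕ) : ℝ) < specRad (Sgraph n k) ^ 2 := by
  obtain ⟨m, hm⟩ : ∃ m, n - k - 1 = m := ⟨_, rfl⟩
  have hm1 : (1 : ℝ) ≤ m := by exact_mod_cast (by omega : 1 ≤ m)
  have hn1 : (1 : ℝ) ≤ n := by exact_mod_cast (by omega : 1 ≤ n)
  rw [hm]
  push_cast
  set r : ℝ := Real.sqrt (n * m) with hr
  have hr2 : r ^ 2 = n * m := Real.sq_sqrt (by positivity)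
  have hr0 : 0 < r := Real.sqrt_pos.2 (by positivity)
  let w : Fin n ⊕ Fin (n - 1) → ℝ := Sum.elim (fun _ => (m : ℝ)) (fun y => if y.val < m then r else 0)
  have hcard : (Finset.univ.filter fun y : Fin (n - 1) => y.val < m).card = m := by
    rw [Fin.card_filter_val_lt]; omega
  have hAl : ∀ x : Fin n, ((Sgraph n k).adjMatrix ℝ).mulVec w (Sum.inl x) = m * r := by
    intro x
    simp only [Matrix.mulVec, dotProduct, Fintype.sum_sum_type, SimpleGraph.adjMatrix_apply,
      (Sgraph_cross n k).1, if_false, zero_mul, Finset.sum_const_zero, zero_add, Sgraph_adj, hm]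
    have : ∀ y : Fin (n - 1), (if x.val < k ∨ y.val < m then (1 : ℝ) else 0) * w (Sum.inr y)
        = if y.val < m then r else 0 := by
      intro y
      simp only [w, Sum.elim_inr]
      by_cases h : y.val < m <;> simp [h]
    rw [Finset.sum_congr rfl fun y _ => this y, ← Finset.sum_filter, Finset.sum_const, hcard,
      nsmul_eq_mul]
  have hAr : ∀ y : Fin (n - 1), y.val < m →
      ((Sgraph n k).adjMatrix ℝ).mulVec w (Sum.inr y) = n * m := by
    intro y hy
    simp only [Matrix.mulVec, dotProduct, Fintype.sum_sum_type, SimpleGraph.adjMatrix_apply,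
      (Sgraph_cross n k).2, if_false, zero_mul, Finset.sum_const_zero, add_zero,
      (Sgraph n k).adj_comm (Sum.inr y), Sgraph_adj, hm]
    simp [w, hy]
  have hw : w ≠ 0 := by
    intro h
    have := congrFun h (Sum.inl ⟨0, by omega⟩)
    simp [w] at this
    rw [this] at hm1
    norm_num at hm1
  have hquad : w ⬝ᵥ ((Sgraph n k).adjMatrix ℝ).mulVec w = r * (w ⬝ᵥ w) := by
    simp only [dotProduct, Finset.mul_sum]
    refine Finset.sum_congr rfl fun v _ => ?_
    rcases v with x | y
    · rw [hAl]; simp only [w, Sum.elim_inl]; ring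
    · by_cases hy : y.val < m
      · rw [hAr y hy, ← hr2]; simp only [w, Sum.elim_inr, if_pos hy]; ring
      · simp only [w, Sum.elim_inr, if_neg hy]; ring
  have hpos := dot_self_pos hw
  have hle : r ≤ specRad (Sgraph n k) := by
    have := rayleigh_le (Sgraph n k) w
    rw [hquad] at this
    exact le_of_mul_le_mul_right this hpos
  have hlt : r < specRad (Sgraph n k) := by
    refine lt_of_le_of_ne hle fun heq => ?_
    have h1 := rayleigh_eq (Sgraph n k) w (by rw [hquad, ← heq])
    have h2 := congrFun h1 (Sum.inr ⟨n - 2, by omega⟩)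
    have h3 : w (Sum.inr ⟨n - 2, by omega⟩) = 0 := by
      simp only [w, Sum.elim_inr]
      rw [if_neg (by omega)]
    rw [Pi.smul_apply, h3, smul_zero] at h2
    simp only [Matrix.mulVec, dotProduct] at h2
    rw [Finset.sum_eq_zero_iff_of_nonneg (fun i _ => mul_nonneg (by
      rw [SimpleGraph.adjMatrix_apply]; split_ifs <;> norm_num) (by
        rcases i with i | i
        · simp [w]
        · simp only [w, Sum.elim_inr]; split_ifs
          · exact hr0.le
          · exact le_rfl))] at h2
    have h4 := h2 (Sum.inl ⟨0, by omega⟩) (Finset.mem_univ _)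
    rw [SimpleGraph.adjMatrix_apply, if_pos (SimpleGraph.Adj.symm
      ((Sgraph_adj n k ⟨0, by omega⟩ ⟨n - 2, by omega⟩).2 (Or.inl hk)))] at h4
    simp [w] at h4
    rw [h4] at hm1
    norm_num at hm1
  rw [← hr2]
  exact pow_lt_pow_left₀ hlt hr0.le (by norm_num)

theorem card_lt_aux (N m : ℕ) (d : DecidablePred fun y : Fin N => y.val < m) :
    (@Finset.filter _ (fun y : Fin N => y.val < m) d Finset.univ).card = min N m := by
  convert Fin.card_filter_val_lt

theorem card_mem_aux {α : Type*} [Fintype α] (B : Finset α) (d : DecidablePred fun y => y ∈ B) :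
    (@Finset.filter _ (fun y => y ∈ B) d Finset.univ).card = B.card := by
  congr 1
  ext x
  simp

theorem exists_equiv_fin {N : ℕ} (p q : Fin N → Prop)
    (h : (Finset.univ.filter p).card = (Finset.univ.filter q).card) :
    ∃ e : Fin N ≃ Fin N, ∀ x, p x ↔ q (e x) := by
  have h' : Fintype.card {x // p x} = Fintype.card {x // q x} := by
    rw [Fintype.card_subtype, Fintype.card_subtype]; exact h
  let e₀ := Fintype.equivOfCardEq h'
  refine ⟨e₀.extendSubtype, fun x => ⟨e₀.extendSubtype_mem x, fun hq => ?_⟩⟩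
  by_contra hp
  exact e₀.extendSubtype_not_mem x hp hq

/-- A nearly balanced bipartite graph on `2n-1` vertices with `δ(G) ≥ k ≥ 1`, `n ≥ (k+1)²`
and `ρ(G) ≥ ρ(S_n^k)` is traceable unless `G = S_n^k`. -/
theorem stmt_19 (n k : ℕ) (G : SimpleGraph (Fin n ⊕ Fin (n - 1))) (hbip : CrossOnly G)
    (hk : 1 ≤ k) (hn : (k + 1) ^ 2 ≤ n) (hdeg : ∀ v, k ≤ G.degree v)
    (hρ : specRad (Sgraph n k) ≤ specRad G) :
    G.IsTraceable ∨ Nonempty (G ≃g Sgraph n k) := by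
  by_cases hT : G.IsTraceable
  · exact Or.inl hT
  right
  have hnk : 2 * k + 2 ≤ n := by nlinarith
  have : Nonempty (Fin n ⊕ Fin (n - 1)) := ⟨Sum.inl ⟨0, by omega⟩⟩
  have hlow := Sgraph_lower n k hk (by omega)
  have hup := specRad_sq_le G hbip
  have hE : n * (n - k - 1) <
      ∑ b, (Finset.univ.filter fun a => G.Adj (Sum.inl a) (Sum.inr b)).card := by
    have h0 : 0 ≤ specRad (Sgraph n k) := by
      obtain ⟨z, hz, h⟩ := specRad_eigvec (Sgraph n k)
      have h1 := rayleigh_le (Sgraph n k) (fun _ => 1)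
      have h2 : 0 ≤ (fun _ => (1 : ℝ)) ⬝ᵥ ((Sgraph n k).adjMatrix ℝ).mulVec (fun _ => 1) := by
        simp only [dotProduct, Matrix.mulVec, SimpleGraph.adjMatrix_apply]
        refine Finset.sum_nonneg fun i _ => mul_nonneg zero_le_one (Finset.sum_nonneg fun j _ => ?_)
        split_ifs <;> norm_num
      have h3 : 0 < (fun _ : Fin n ⊕ Fin (n - 1) => (1 : ℝ)) ⬝ᵥ (fun _ => 1) :=
        dot_self_pos (fun h => one_ne_zero (congrFun h (Sum.inl ⟨0, by omega⟩)))
      exact nonneg_of_mul_nonneg_left (h2.trans h1) h3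
    have h1 := pow_le_pow_left₀ h0 hρ 2
    exact_mod_cast hlow.trans_le (h1.trans hup)
  obtain ⟨S, B, hS, hB, hSB⟩ := nontraceable_struct n k G hk hn
    (by
      intro a
      refine (hdeg (Sum.inl a)).trans ?_
      rw [← SimpleGraph.card_neighborFinset_eq_degree]
      refine (Finset.card_le_card (t := (Finset.univ.filter fun b =>
        G.Adj (Sum.inl a) (Sum.inr b)).image Sum.inr) ?_).trans Finset.card_image_le
      intro v hv
      rw [SimpleGraph.mem_neighborFinset] at hv
      rcases v with v | v
      · exact absurd hv (hbip.1 _ _)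
      · exact Finset.mem_image.2 ⟨v, by simpa using hv, rfl⟩)
    (by
      intro b
      refine (hdeg (Sum.inr b)).trans ?_
      rw [← SimpleGraph.card_neighborFinset_eq_degree]
      refine (Finset.card_le_card (t := (Finset.univ.filter fun a =>
        G.Adj (Sum.inl a) (Sum.inr b)).image Sum.inl) ?_).trans Finset.card_image_le
      intro v hv
      rw [SimpleGraph.mem_neighborFinset] at hv
      rcases v with v | v
      · exact Finset.mem_image.2 ⟨v, by simpa using hv.symm, rfl⟩
      · exact absurd hv (hbip.2 _ _)) hE hT
  obtain ⟨e1, he1⟩ := exists_equiv_fin (fun x => x ∈ B) (fun x => x.val < k) (by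
    rw [card_lt_aux, card_mem_aux, hB]; omega)
  obtain ⟨e2, he2⟩ := exists_equiv_fin (fun y => y ∈ S) (fun y => ¬ y.val < n - k - 1) (by
    have h1 := filter_split (fun y : Fin (n - 1) => y.val < n - k - 1)
    rw [card_lt_aux, Fintype.card_fin] at h1
    rw [card_mem_aux, hS]
    have h2 : k = n - 1 - min (n - 1) (n - k - 1) := by omega
    have h3 := Nat.eq_sub_of_add_eq' h1
    rw [← h2] at h3
    refine h3.symm.trans ?_
    congr)
  let e : Fin n ⊕ Fin (n - 1) ≃ Fin n ⊕ Fin (n - 1) := Equiv.sumCongr e1 e2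
  have hcr : ∀ a b, G.Adj (Sum.inl a) (Sum.inr b) →
      (Sgraph n k).Adj (Sum.inl (e1 a)) (Sum.inr (e2 b)) := by
    intro a b hab
    rw [Sgraph_adj]
    by_cases hb : b ∈ S
    · exact Or.inl ((he1 a).1 (hSB b hb a hab))
    · right
      by_contra h
      exact hb ((he2 b).2 h)
  have he : ∀ a b, G.Adj a b → (Sgraph n k).Adj (e a) (e b) := by
    intro a b hab
    rcases a with a | a <;> rcases b with b | b
    · exact absurd hab (hbip.1 _ _)
    · exact hcr a b hab
    · exact (hcr b a hab.symm).symm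
    · exact absurd hab (hbip.2 _ _)
  have hconv := mono_eq G (Sgraph n k) (Sgraph_connected n k hk (by omega)) e he hρ
  exact ⟨⟨e, fun {a b} => ⟨hconv a b, he a b⟩⟩⟩
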